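/- Suppose D = (K/F,σ,c) is a division algebra and d ∈ F ∖ F₀. Then the left nucleus and the middle nucleus of the tensor product algebra A = (L/F₀,σ,c) ⊗_{F₀} (F/F₀,τ,d) both equal the subalgebra D, i.e. Nuc_l(A) = Nuc_m(A) = {x ∈ A : the fʲ-coefficients of x vanish for all j ≥ 1}. -/

import Mathlib

/-!
Setup: `K` is a field, `σ τ : K ≃+* K` are commuting automorphisms of orders `n`, `m`
generating a group of order `n*m` (encoded by `hindep`); `F = Fix σ`, `L = Fix τ`,
`F₀ = Fix σ ∩ Fix τ`, so that `K/F₀` is Galois with group `⟨σ⟩ × ⟨τ⟩`.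

`cycMul` is the multiplication of the associative cyclic algebra `D = (K/F,σ,c)` of degree `n`,
realized on `Fin n → K` (the coefficients w.r.t. the right `K`-basis `{1, e, …, e^{n-1}}`),
via `(eⁱ a)(eᵏ b) = e^{(i+k) % n} c^{(i+k)/n} σᵏ(a) b`.

`tenMul` is the multiplication of the tensor product algebra
`A = (L/F₀,σ,c) ⊗_{F₀} (F/F₀,τ,d)`, realized on `Fin n → Fin m → K`
(the coefficients w.r.t. the `K`-basis `{eⁱ fʲ}`), via
`(eⁱfʲ a)(eᵏfˡ b) = e^{(i+k) % n} f^{(j+l) % m} c^{(i+k)/n} d^{(j+l)/m} σᵏ(τˡ(a)) b`.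
-/

/-- Multiplication of the cyclic algebra `(K/F,σ,c)` on coefficients `Fin n → K`. -/
noncomputable def cycMul {K : Type*} [Field K] (n : ℕ) (σ : K ≃+* K) (c : K)
    (x y : Fin n → K) : Fin n → K :=
  fun r => ∑ i : Fin n, ∑ k : Fin n,
    if ((i : ℕ) + (k : ℕ)) % n = (r : ℕ) then
      c ^ (((i : ℕ) + (k : ℕ)) / n) * (σ ^ (k : ℕ)) (x i) * y k
    else 0

/-- Multiplication of the tensor product algebra `(L/F₀,σ,c) ⊗_{F₀} (F/F₀,τ,d)` on
coefficients `Fin n → Fin m → K`. -/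
noncomputable def tenMul {K : Type*} [Field K] (n m : ℕ) (σ τ : K ≃+* K) (c d : K)
    (x y : Fin n → Fin m → K) : Fin n → Fin m → K :=
  fun r s => ∑ i : Fin n, ∑ j : Fin m, ∑ k : Fin n, ∑ l : Fin m,
    if ((i : ℕ) + (k : ℕ)) % n = (r : ℕ) ∧ ((j : ℕ) + (l : ℕ)) % m = (s : ℕ) then
      c ^ (((i : ℕ) + (k : ℕ)) / n) * d ^ (((j : ℕ) + (l : ℕ)) / m) *
        (σ ^ (k : ℕ)) ((τ ^ (l : ℕ)) (x i j)) * y k l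
    else 0

/-- The scalar `d ∈ K` viewed as the element `e⁰ d` of the cyclic algebra. -/
noncomputable def delta0 {K : Type*} [Field K] (n : ℕ) (d : K) : Fin n → K :=
  fun i => if (i : ℕ) = 0 then d else 0

/-- The (left-associated) product `z · τ̃(z) · τ̃²(z) ⋯ τ̃^{j-1}(z)` in the cyclic algebra
`D = (K/F,σ,c)`, where `τ̃` applies `τ` to each `K`-coefficient. -/
noncomputable def zProd {K : Type*} [Field K] (n : ℕ) (σ τ : K ≃+* K) (c : K)
    (z : Fin n → K) : ℕ → (Fin n → K)
  | 0 => delta0 n 1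
  | (j + 1) => cycMul n σ c (zProd n σ τ c z j) (fun i => (τ ^ j) (z i))

/-- The monomial `eⁱ fʲ a`. -/
noncomputable def tenMonomial {K : Type*} [Field K] {n m : ℕ} (i : Fin n) (j : Fin m) (a : K) :
    Fin n → Fin m → K :=
  Pi.single i (Pi.single j a)

theorem tenMonomial_apply {K : Type*} [Field K] {n m : ℕ} (i : Fin n) (j : Fin m) (a : K)
    (r : Fin n) (s : Fin m) :
    tenMonomial i j a r s = if r = i ∧ s = j then a else 0 := by
  unfold tenMonomial
  by_cases hr : r = i
  · subst hr
    by_cases hs : s = j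
    · subst hs; simp
    · simp [hs]
  · simp [hr]

theorem sum_tenMonomial {K : Type*} [Field K] {n m : ℕ} (x : Fin n → Fin m → K) :
    ∑ i, ∑ j, tenMonomial i j (x i j) = x := by
  ext r s
  simp [Finset.sum_apply, tenMonomial_apply, ite_and]

/-- The multiplication `tenMul` as a biadditive map. -/
noncomputable def tenMulHom {K : Type*} [Field K] (n m : ℕ) (σ τ : K ≃+* K) (c d : K) :
    (Fin n → Fin m → K) →+ (Fin n → Fin m → K) →+ (Fin n → Fin m → K) :=
  AddMonoidHom.mk' (fun x => AddMonoidHom.mk' (tenMul n m σ τ c d x) (by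
      intro y z
      ext r s
      simp only [tenMul, Pi.add_apply, ← Finset.sum_add_distrib]
      refine Finset.sum_congr rfl fun i _ => Finset.sum_congr rfl fun j _ =>
        Finset.sum_congr rfl fun k _ => Finset.sum_congr rfl fun l _ => ?_
      split_ifs <;> ring)) (by
    intro x y
    refine AddMonoidHom.ext fun z => funext fun r => funext fun s => ?_
    simp only [AddMonoidHom.mk'_apply, AddMonoidHom.add_apply, tenMul, Pi.add_apply,
      ← Finset.sum_add_distrib, map_add]
    refine Finset.sum_congr rfl fun i _ => Finset.sum_congr rfl fun j _ =>
      Finset.sum_congr rfl fun k _ => Finset.sum_congr rfl fun l _ => ?_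
    split_ifs <;> ring)

theorem tenMulHom_apply {K : Type*} [Field K] (n m : ℕ) (σ τ : K ≃+* K) (c d : K)
    (x y : Fin n → Fin m → K) : tenMulHom n m σ τ c d x y = tenMul n m σ τ c d x y := rfl

theorem tenMul_tenMonomial {K : Type*} [Field K] {n m : ℕ} (σ τ : K ≃+* K) (c d : K)
    (i k : Fin n) (j l : Fin m) (a b : K) :
    tenMul n m σ τ c d (tenMonomial i j a) (tenMonomial k l b) =
      tenMonomial (i + k) (j + l)
        (c ^ (((i : ℕ) + (k : ℕ)) / n) * d ^ (((j : ℕ) + (l : ℕ)) / m) *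
          (σ ^ (k : ℕ)) ((τ ^ (l : ℕ)) a) * b) := by
  ext r s
  unfold tenMul
  rw [Finset.sum_eq_single i, Finset.sum_eq_single j, Finset.sum_eq_single k,
    Finset.sum_eq_single l]
  · simp [tenMonomial_apply, Fin.ext_iff, Fin.val_add, eq_comm]
  all_goals simp +contextual [tenMonomial_apply]

theorem Nat.mod_add_div_add_div (a b n : ℕ) (hn : 0 < n) :
    (a % n + b) / n + a / n = (a + b) / n := by
  conv_rhs => rw [← Nat.mod_add_div a n, add_right_comm, Nat.add_mul_div_left _ _ hn]

/-- Monomials `x, y, z` associate as soon as the `f`-degrees of `x` and `y` add up to less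
than `m`. -/
theorem tenMul_assoc_tenMonomial {K : Type*} [Field K] {n m : ℕ}
    {σ τ : K ≃+* K} (hσord : orderOf σ = n) (hτord : orderOf τ = m) (hcomm : σ * τ = τ * σ)
    {c : K} (hcσ : σ c = c) (hcτ : τ c = c) (d : K)
    (i k p : Fin n) (j l q : Fin m) (hjl : (j : ℕ) + l < m) (a b g : K) :
    tenMul n m σ τ c d (tenMul n m σ τ c d (tenMonomial i j a) (tenMonomial k l b))
        (tenMonomial p q g) =
      tenMul n m σ τ c d (tenMonomial i j a)
        (tenMul n m σ τ c d (tenMonomial k l b) (tenMonomial p q g)) := by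
  have hn : 0 < n := i.pos
  have hm : 0 < m := j.pos
  have fixed : ∀ (ρ : K ≃+* K) (e : ℕ), ρ c = c → (ρ ^ e) c = c := by
    intro ρ e h
    induction e with
    | zero => rfl
    | succ e ih => rw [pow_succ, RingAut.mul_apply, h, ih]
  have hσ : σ ^ (((k : ℕ) + p) % n) = σ ^ (p : ℕ) * σ ^ (k : ℕ) := by
    rw [← pow_add, add_comm (p : ℕ)]
    exact hσord ▸ pow_mod_orderOf σ ((k : ℕ) + p)
  have hτ : τ ^ (((l : ℕ) + q) % m) = τ ^ (q : ℕ) * τ ^ (l : ℕ) := by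
    rw [← pow_add, add_comm (q : ℕ)]
    exact hτord ▸ pow_mod_orderOf τ ((l : ℕ) + q)
  have hστ : σ ^ (k : ℕ) * τ ^ (q : ℕ) = τ ^ (q : ℕ) * σ ^ (k : ℕ) :=
    (Commute.pow_pow (show Commute σ τ from hcomm) _ _).eq
  have hστ' : ∀ u, (σ ^ (k : ℕ)) ((τ ^ (q : ℕ)) u) = (τ ^ (q : ℕ)) ((σ ^ (k : ℕ)) u) :=
    fun u => DFunLike.congr_fun hστ u
  simp only [tenMul_tenMonomial, add_assoc]
  congr 1
  simp only [Fin.val_add, hσ, hτ, RingAut.mul_apply, map_mul, map_pow, fixed σ _ hcσ,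
    fixed τ _ hcτ, hστ']
  have hc : c ^ ((((i : ℕ) + k) % n + p) / n) * c ^ (((i : ℕ) + k) / n) =
      c ^ (((i : ℕ) + (k + p) % n) / n) * c ^ (((k : ℕ) + p) / n) := by
    rw [← pow_add, ← pow_add, Nat.mod_add_div_add_div _ _ _ hn, add_comm (i : ℕ) (_ % n),
      Nat.mod_add_div_add_div _ _ _ hn]
    congr 2; ring
  have hd : d ^ ((((j : ℕ) + l) % m + q) / m) =
      d ^ (((j : ℕ) + (l + q) % m) / m) * d ^ (((l : ℕ) + q) / m) := by
    rw [← pow_add, add_comm (j : ℕ) (_ % m), Nat.mod_add_div_add_div _ _ _ hm,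
      Nat.mod_eq_of_lt hjl]
    congr 2; ring
  rw [hd, Nat.div_eq_of_lt hjl]
  simp only [pow_zero]
  linear_combination (d ^ (((j : ℕ) + (l + q) % m) / m) * d ^ (((l : ℕ) + q) / m) *
    (σ ^ (p : ℕ)) ((τ ^ (q : ℕ)) ((σ ^ (k : ℕ)) ((τ ^ (l : ℕ)) a))) *
    (σ ^ (p : ℕ)) ((τ ^ (q : ℕ)) b) * g) * hc

/-- Associativity of `tenMul` on a triple follows from associativity on the monomials
occurring in it. -/
theorem tenMul_assoc_of_tenMonomial {K : Type*} [Field K] {n m : ℕ} {σ τ : K ≃+* K} {c d : K}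
    {x y z : Fin n → Fin m → K}
    (h : ∀ i j k l p q,
      tenMul n m σ τ c d (tenMul n m σ τ c d (tenMonomial i j (x i j)) (tenMonomial k l (y k l)))
          (tenMonomial p q (z p q)) =
        tenMul n m σ τ c d (tenMonomial i j (x i j))
          (tenMul n m σ τ c d (tenMonomial k l (y k l)) (tenMonomial p q (z p q)))) :
    tenMul n m σ τ c d (tenMul n m σ τ c d x y) z =
      tenMul n m σ τ c d x (tenMul n m σ τ c d y z) := by
  rw [← sum_tenMonomial x, ← sum_tenMonomial y, ← sum_tenMonomial z]
  simp only [← tenMulHom_apply] at h ⊢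
  simp only [map_sum, AddMonoidHom.finsetSum_apply, h]

theorem tenMonomial_zero {K : Type*} [Field K] {n m : ℕ} (i : Fin n) (j : Fin m) :
    tenMonomial i j (0 : K) = 0 := by
  simp [tenMonomial]

theorem Fin.eq_of_add_mod_eq {m : ℕ} {j j' : Fin m} {l : ℕ}
    (h : ((j : ℕ) + l) % m = ((j' : ℕ) + l) % m) : j = j' := by
  have := Nat.ModEq.add_right_cancel' l h
  exact Fin.ext (Nat.ModEq.eq_of_lt_of_lt this j.2 j'.2)

/-- A coefficient of `x * (fˡ b)`. -/
theorem tenMul_tenMonomial_right_apply {K : Type*} [Field K] {n m : ℕ} [NeZero n]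
    (σ τ : K ≃+* K) (c d : K) (x : Fin n → Fin m → K) (l : Fin m) (b : K) (i : Fin n)
    (j : Fin m) :
    tenMul n m σ τ c d x (tenMonomial 0 l b) i (j + l) =
      d ^ (((j : ℕ) + l) / m) * (τ ^ (l : ℕ)) (x i j) * b := by
  unfold tenMul
  rw [Finset.sum_eq_single i, Finset.sum_eq_single j, Finset.sum_eq_single 0,
    Finset.sum_eq_single l]
  · simp [tenMonomial_apply, Fin.val_add, Nat.mod_eq_of_lt, Nat.div_eq_of_lt]
  · simp +contextual [tenMonomial_apply]
  · simp
  · simp +contextual [tenMonomial_apply]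
  · simp
  · intro j' _ hj'
    refine Finset.sum_eq_zero fun k _ => Finset.sum_eq_zero fun l' _ => ?_
    rw [tenMonomial_apply]
    split_ifs with h1 h2
    · exact absurd (Fin.eq_of_add_mod_eq (l := l) (by rw [← Fin.val_add j, ← h1.2, h2.2])) hj'
    · simp
    · rfl
  · simp
  · intro i' _ hi'
    refine Finset.sum_eq_zero fun j' _ => Finset.sum_eq_zero fun k _ =>
      Finset.sum_eq_zero fun l' _ => ?_
    rw [tenMonomial_apply]
    split_ifs with h1 h2
    · refine absurd (Fin.ext ?_) hi'
      simpa [h2.1, Nat.mod_eq_of_lt] using h1.1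
    · simp
    · rfl
  · simp

/-- A coefficient of `fˡ * x`. -/
theorem tenMul_tenMonomial_left_apply {K : Type*} [Field K] {n m : ℕ} [NeZero n]
    (σ τ : K ≃+* K) (c d : K) (x : Fin n → Fin m → K) (l : Fin m) (i : Fin n) (j : Fin m) :
    tenMul n m σ τ c d (tenMonomial 0 l 1) x i (l + j) = d ^ (((l : ℕ) + j) / m) * x i j := by
  unfold tenMul
  rw [Finset.sum_eq_single 0, Finset.sum_eq_single l, Finset.sum_eq_single i,
    Finset.sum_eq_single j]
  · simp [tenMonomial_apply, Fin.val_add, Nat.mod_eq_of_lt, Nat.div_eq_of_lt]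
  · intro j' _ hj'
    rw [if_neg]
    rintro ⟨-, h⟩
    refine hj' (Fin.eq_of_add_mod_eq (l := l) ?_)
    rw [add_comm, h, Fin.val_add, add_comm]
  · simp
  · intro i' _ hi'
    refine Finset.sum_eq_zero fun l' _ => ?_
    rw [if_neg]
    rintro ⟨h, -⟩
    refine hi' (Fin.ext ?_)
    simpa [Nat.mod_eq_of_lt] using h
  · simp
  · simp +contextual [tenMonomial_apply]
  · simp
  · simp +contextual [tenMonomial_apply]
  · simp

/-- Suppose `D = (K/F,σ,c)` is a division algebra and `d ∈ F ∖ F₀`. Then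
the left nucleus and the middle nucleus of `A = (L/F₀,σ,c) ⊗_{F₀} (F/F₀,τ,d)` both equal the
subalgebra `D = {x ∈ A : the fʲ-coefficients of x vanish for all j ≥ 1}`. -/
theorem tensor_left_middle_nucleus {K : Type*} [Field K] (n m : ℕ)
    (hn : 0 < n) (hm : 0 < m)
    (σ τ : K ≃+* K) (hσord : orderOf σ = n) (hτord : orderOf τ = m)
    (hcomm : σ * τ = τ * σ)
    (hindep : ∀ i j : ℕ, i < n → j < m → σ ^ i * τ ^ j = 1 → i = 0 ∧ j = 0)
    (c : K) (hc0 : c ≠ 0) (hcσ : σ c = c) (hcτ : τ c = c)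
    (d : K) (hd0 : d ≠ 0) (hdσ : σ d = d) (hdτ : τ d ≠ d)
    (hD : ∀ x y : Fin n → K, x ≠ 0 → y ≠ 0 → cycMul n σ c x y ≠ 0) :
    ∀ x : Fin n → Fin m → K,
      ((∀ y z : Fin n → Fin m → K,
          tenMul n m σ τ c d (tenMul n m σ τ c d x y) z
            = tenMul n m σ τ c d x (tenMul n m σ τ c d y z)) ↔
        ∀ (i : Fin n) (j : Fin m), (j : ℕ) ≠ 0 → x i j = 0) ∧
      ((∀ y z : Fin n → Fin m → K,
          tenMul n m σ τ c d (tenMul n m σ τ c d y x) z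
            = tenMul n m σ τ c d y (tenMul n m σ τ c d x z)) ↔
        ∀ (i : Fin n) (j : Fin m), (j : ℕ) ≠ 0 → x i j = 0) := by
  have : NeZero n := ⟨hn.ne'⟩
  have : NeZero m := ⟨hm.ne'⟩
  have hm1 : 1 < m := by
    by_contra h
    have h1 : orderOf τ = 1 := by omega
    rw [orderOf_eq_one_iff] at h1
    exact hdτ (by rw [h1]; rfl)
  let one : Fin m := ⟨1, hm1⟩
  have cancel : ∀ {a : K}, a * τ d = a * d → a = 0 := by
    intro a h
    by_contra ha
    exact hdτ (mul_left_cancel₀ ha h)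
  intro x
  refine ⟨⟨fun h i j hj => ?_, fun h y z => ?_⟩, ⟨fun h i j hj => ?_, fun h y z => ?_⟩⟩
  · let l : Fin m := ⟨m - j, by omega⟩
    have hl : (l : ℕ) = m - j := rfl
    have hjl : (j : ℕ) + l = m := by omega
    have key := congrFun (congrFun (h (tenMonomial 0 l 1) (tenMonomial 0 one 1)) i) (j + l + one)
    have hv : ((j + l : Fin m) : ℕ) = 0 := by rw [Fin.val_add, hjl, Nat.mod_self]
    rw [tenMul_tenMonomial_right_apply, tenMul_tenMonomial_right_apply, tenMul_tenMonomial,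
      add_assoc, add_zero, tenMul_tenMonomial_right_apply, hv, hjl, Nat.div_self hm] at key
    have hτ : τ ^ ((l + one : Fin m) : ℕ) = τ * τ ^ (l : ℕ) := by
      rw [Fin.val_add, ← pow_succ']
      exact hτord ▸ pow_mod_orderOf τ ((l : ℕ) + 1)
    have hcarry : (((j : ℕ) + (l + one : Fin m)) / m) + ((l : ℕ) + 1) / m = 1 := by
      rw [Fin.val_add, add_comm (j : ℕ), Nat.mod_add_div_add_div _ _ _ hm,
        show (l : ℕ) + 1 + j = 1 + m by omega, Nat.add_div_right _ hm, Nat.div_eq_of_lt hm1]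
    have hone : (one : ℕ) = 1 := rfl
    have hpow := congrArg (d ^ ·) hcarry
    simp only [pow_add, pow_one] at hpow
    simp only [hτ, hone, RingAut.mul_apply, Nat.div_eq_of_lt hm1, zero_add, pow_zero, pow_one,
      map_mul, map_one, mul_one, one_mul, Fin.val_zero, add_zero, Nat.zero_div] at key
    have h0 : τ ((τ ^ (l : ℕ)) (x i j)) = 0 := by
      apply cancel
      linear_combination key + τ ((τ ^ (l : ℕ)) (x i j)) * hpow
    rwa [map_eq_zero, map_eq_zero] at h0
  · refine tenMul_assoc_of_tenMonomial fun i j k l p q => ?_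
    by_cases hj : (j : ℕ) = 0
    · exact tenMul_assoc_tenMonomial hσord hτord hcomm hcσ hcτ d _ _ _ _ _ _ (by omega) _ _ _
    · rw [h i j hj, tenMonomial_zero]
      simp only [← tenMulHom_apply, map_zero, AddMonoidHom.zero_apply]
  · let l : Fin m := ⟨m - j, by omega⟩
    have hl : (l : ℕ) = m - j := rfl
    have hlj : (l : ℕ) + j = m := by omega
    have key := congrFun (congrFun (h (tenMonomial 0 l 1) (tenMonomial 0 one 1)) i) (l + j + one)
    have hv : ((l + j : Fin m) : ℕ) = 0 := by rw [Fin.val_add, hlj, Nat.mod_self]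
    rw [tenMul_tenMonomial_right_apply, tenMul_tenMonomial_left_apply, add_assoc,
      tenMul_tenMonomial_left_apply, tenMul_tenMonomial_right_apply, hv, hlj,
      Nat.div_self hm] at key
    have hcarry : (((l : ℕ) + (j + one : Fin m)) / m) + ((j : ℕ) + 1) / m = 1 := by
      rw [Fin.val_add, add_comm (l : ℕ), Nat.mod_add_div_add_div _ _ _ hm,
        show (j : ℕ) + 1 + l = 1 + m by omega, Nat.add_div_right _ hm, Nat.div_eq_of_lt hm1]
    have hone : (one : ℕ) = 1 := rfl
    have hpow := congrArg (d ^ ·) hcarry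
    simp only [pow_add, pow_one] at hpow
    simp only [hone, Nat.div_eq_of_lt hm1, zero_add, pow_zero, pow_one, map_mul, mul_one,
      one_mul] at key
    have h0 : τ (x i j) = 0 := by
      apply cancel
      linear_combination key + τ (x i j) * hpow
    simpa using h0
  · refine tenMul_assoc_of_tenMonomial fun i j k l p q => ?_
    by_cases hl : (l : ℕ) = 0
    · exact tenMul_assoc_tenMonomial hσord hτord hcomm hcσ hcτ d _ _ _ _ _ _ (by omega) _ _ _
    · rw [h k l hl, tenMonomial_zero]
      simp only [← tenMulHom_apply, map_zero, AddMonoidHom.zero_apply]
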